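/- Let F be an almost superadditive random process with finite time constant. Then the limit lim_{n→∞} (1/|S_n|) F_{S_n}(ω) exists for almost every ω. -/

import Mathlib

open MeasureTheory Filter

/-- Adjacency in `ℤ₊^d`: `x ∼ y` iff their `l¹`-distance is 1. -/
def adjN {d : ℕ} (x y : Fin d → ℕ) : Prop := (∑ i, ((x i : ℤ) - (y i : ℤ)).natAbs) = 1

/-- A box in `ℤ₊^d`: a product of intervals `[aᵢ, bᵢ)` with `aᵢ < bᵢ`. -/
def IsBoxN {d : ℕ} (B : Finset (Fin d → ℕ)) : Prop :=
  ∃ a b : Fin d → ℕ, (∀ i, a i < b i) ∧ B = Fintype.piFinset fun i => Finset.Ico (a i) (b i)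

/-- The hypercube `S_n = [0,n)^d ∩ ℤ₊^d`. -/
def cubeN (d n : ℕ) : Finset (Fin d → ℕ) := Fintype.piFinset fun _ => Finset.range n

/-- The inner boundary `∂B = {x ∈ B : ∃ y ∉ B, x ∼ y}`. -/
noncomputable def ibdN {d : ℕ} (B : Finset (Fin d → ℕ)) : Finset (Fin d → ℕ) :=
  @Finset.filter _ (fun x => ∃ y, y ∉ B ∧ adjN x y) (Classical.decPred _) B

/-- An almost superadditive random process `F = (F_B)` indexed by boxes of `ℤ₊^d`,
relative to a measure-preserving semigroup `(τ_u)` and with defect random variable `A`. -/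
structure AlmostSuperadditive {d : ℕ} {Ω : Type*} [MeasurableSpace Ω] (μ : Measure Ω)
    (τ : (Fin d → ℕ) → Ω → Ω) (F : Finset (Fin d → ℕ) → Ω → ℝ) (A : Ω → ℝ) : Prop where
  meas : ∀ u, MeasurePreserving (τ u) μ μ
  semigroup : ∀ u v, τ (u + v) = τ u ∘ τ v
  int : ∀ B, IsBoxN B → Integrable (F B) μ
  shift : ∀ (u : Fin d → ℕ) (B : Finset (Fin d → ℕ)), IsBoxN B →
    F (B.image fun x => u + x) = (F B) ∘ (τ u)
  Anonneg : ∀ ω, 0 ≤ A ω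
  Aint : Integrable A μ
  superadd : ∀ (k : ℕ) (Bs : Fin k → Finset (Fin d → ℕ)),
    (∀ i, IsBoxN (Bs i)) →
    (∀ i j, i ≠ j → Disjoint (Bs i) (Bs j)) →
    IsBoxN (Finset.univ.biUnion Bs) →
    ∀ ω, (∑ i, F (Bs i) ω) - A ω * (∑ i, ((ibdN (Bs i)).card : ℝ))
      ≤ F (Finset.univ.biUnion Bs) ω

/-- The normalized expectations `n ↦ |S_n|⁻¹ E[F_{S_n}]`. -/
noncomputable def avgSeq {d : ℕ} {Ω : Type*} [MeasurableSpace Ω] (μ : Measure Ω)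
    (F : Finset (Fin d → ℕ) → Ω → ℝ) (n : ℕ) : ℝ :=
  (∫ ω, F (cubeN d n) ω ∂μ) / (n : ℝ) ^ d

/-- The time constant `γ̃(F) = limsup_n |S_n|⁻¹ E[F_{S_n}]`. -/
noncomputable def timeConst {d : ℕ} {Ω : Type*} [MeasurableSpace Ω] (μ : Measure Ω)
    (F : Finset (Fin d → ℕ) → Ω → ℝ) : ℝ :=
  limsup (avgSeq μ F) atTop

/-- The cube of side `n` with lowest corner `y`. -/
def shiftedCube {d : ℕ} (y : Fin d → ℕ) (n : ℕ) : Finset (Fin d → ℕ) :=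
  Fintype.piFinset fun i => Finset.Ico (y i) (y i + n)

section Cubes

variable {d : ℕ}

lemma mem_cubeN {n : ℕ} {x : Fin d → ℕ} : x ∈ cubeN d n ↔ ∀ i, x i < n := by
  simp [cubeN]

lemma mem_shiftedCube {n : ℕ} {x y : Fin d → ℕ} :
    x ∈ shiftedCube y n ↔ ∀ i, y i ≤ x i ∧ x i < y i + n := by
  simp [shiftedCube]

lemma card_cubeN (n : ℕ) : (cubeN d n).card = n ^ d := by
  simp [cubeN]

lemma card_shiftedCube (y : Fin d → ℕ) (n : ℕ) : (shiftedCube y n).card = n ^ d := by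
  simp [shiftedCube]

lemma self_mem_shiftedCube (y : Fin d → ℕ) {n : ℕ} (hn : 0 < n) : y ∈ shiftedCube y n := by
  simp [mem_shiftedCube, hn]

lemma shiftedCube_zero (n : ℕ) : shiftedCube (0 : Fin d → ℕ) n = cubeN d n := by
  ext; simp [mem_shiftedCube, mem_cubeN]

lemma isBoxN_shiftedCube (y : Fin d → ℕ) {n : ℕ} (hn : 0 < n) : IsBoxN (shiftedCube y n) :=
  ⟨y, fun i => y i + n, fun _ => Nat.lt_add_of_pos_right hn, rfl⟩

lemma isBoxN_cubeN {n : ℕ} (hn : 0 < n) : IsBoxN (cubeN d n) :=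
  shiftedCube_zero (d := d) n ▸ isBoxN_shiftedCube 0 hn

lemma image_add_cubeN (u : Fin d → ℕ) (n : ℕ) :
    (cubeN d n).image (fun x => u + x) = shiftedCube u n := by
  ext z
  simp only [Finset.mem_image, mem_cubeN, mem_shiftedCube]
  constructor
  · rintro ⟨x, hx, rfl⟩ i
    have := hx i
    simp only [Pi.add_apply]
    omega
  · intro h
    refine ⟨fun i => z i - u i, fun i => ?_, ?_⟩
    · have := h i
      change z i - u i < n
      omega
    · ext i
      have := h i
      simp only [Pi.add_apply]
      omega

lemma card_ibdN_shiftedCube_le (y : Fin d → ℕ) {n : ℕ} (hn : 0 < n) :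
    ((ibdN (shiftedCube y n)).card : ℝ) ≤ 2 * d * ((n : ℝ) ^ d / n) := by
  classical
  let face (i : Fin d) (c : ℕ) : Finset (Fin d → ℕ) :=
    Fintype.piFinset (Function.update (fun j => Finset.Ico (y j) (y j + n)) i {c})
  have hface : ∀ i c, ((face i c).card : ℝ) = (n : ℝ) ^ d / n := by
    intro i c
    have h : (face i c).card * n = n ^ d := by
      have h1 : (face i c).card = ∏ j, Function.update (fun _ : Fin d => n) i 1 j := by
        rw [Fintype.card_piFinset]
        refine Finset.prod_congr rfl fun j _ => ?_
        by_cases hj : j = i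
        · subst hj; simp
        · simp [hj]
      rw [h1, Finset.prod_update_of_mem (Finset.mem_univ i), one_mul, mul_comm]
      have := Finset.mul_prod_erase Finset.univ (fun _ : Fin d => n) (Finset.mem_univ i)
      simpa [Finset.sdiff_singleton_eq_erase] using this
    have hn' : (n : ℝ) ≠ 0 := by positivity
    rw [eq_div_iff hn']
    exact_mod_cast h
  have hsub : ibdN (shiftedCube y n) ⊆
      Finset.univ.biUnion fun i => face i (y i) ∪ face i (y i + n - 1) := by
    intro x hx
    simp only [ibdN, Finset.mem_filter] at hx
    obtain ⟨hx, z, hz, hxz⟩ := hx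
    rw [mem_shiftedCube] at hx hz
    push Not at hz
    obtain ⟨i, hi⟩ := hz
    have hle : ((x i : ℤ) - z i).natAbs ≤ 1 := by
      rw [← hxz]
      exact Finset.single_le_sum (f := fun i => ((x i : ℤ) - (z i : ℤ)).natAbs)
        (fun _ _ => Nat.zero_le _) (Finset.mem_univ i)
    have hmem : ∀ c, x i = c → x ∈ face i c := by
      intro c hc
      rw [Fintype.mem_piFinset]
      intro j
      by_cases hj : j = i
      · subst hj; simp [hc]
      · simpa [hj] using hx j
    simp only [Finset.mem_biUnion, Finset.mem_univ, true_and, Finset.mem_union]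
    refine ⟨i, ?_⟩
    have := hx i
    rcases (by omega : x i = y i ∨ x i = y i + n - 1) with h | h
    · exact Or.inl (hmem _ h)
    · exact Or.inr (hmem _ h)
  calc ((ibdN (shiftedCube y n)).card : ℝ)
      ≤ ∑ i : Fin d, (((face i (y i)).card : ℝ) + (face i (y i + n - 1)).card) := by
        have h1 := (Finset.card_le_card hsub).trans Finset.card_biUnion_le
        have h2 : ∑ i : Fin d, (face i (y i) ∪ face i (y i + n - 1)).card
            ≤ ∑ i : Fin d, ((face i (y i)).card + (face i (y i + n - 1)).card) :=
          Finset.sum_le_sum fun i _ => Finset.card_union_le _ _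
        exact_mod_cast h1.trans h2
    _ = 2 * d * ((n : ℝ) ^ d / n) := by
        simp only [hface, Finset.sum_const, Finset.card_univ, Fintype.card_fin, nsmul_eq_mul]
        ring

/-- Vitali covering: the corners of a finite family of cubes can be covered, up to the constant
`3 ^ d`, by the volume of a disjoint subfamily. -/
lemma exists_disjoint_shiftedCubes (X : Finset (Fin d → ℕ)) (n : (Fin d → ℕ) → ℕ)
    (hn : ∀ x ∈ X, 0 < n x) :
    ∃ Y ⊆ X, (Y : Set (Fin d → ℕ)).PairwiseDisjoint (fun y => shiftedCube y (n y)) ∧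
      X.card ≤ 3 ^ d * ∑ y ∈ Y, n y ^ d := by
  classical
  obtain ⟨u, huX, hdisj, hcov⟩ := Vitali.exists_disjoint_subfamily_covering_enlargement
    (fun x => (shiftedCube x (n x) : Set (Fin d → ℕ))) (X : Set (Fin d → ℕ))
    (fun x => (n x : ℝ)) 2 (by norm_num) (fun _ _ => by positivity) (∑ x ∈ X, n x : ℕ)
    (fun x hx => by
      exact_mod_cast Finset.single_le_sum (f := n) (fun _ _ => Nat.zero_le _) hx)
    (fun x hx => ⟨x, self_mem_shiftedCube x (hn x hx)⟩)
  have hufin : u.Finite := X.finite_toSet.subset huX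
  refine ⟨hufin.toFinset, by simpa using huX, ?_, ?_⟩
  · intro a ha b hb hab
    have := hdisj (by simpa using ha) (by simpa using hb) hab
    simpa [Function.onFun] using this
  · have hsub : X ⊆ hufin.toFinset.biUnion fun y =>
        Fintype.piFinset fun i => Finset.Ico (y i - 2 * n y) (y i + n y) := by
      intro x hx
      obtain ⟨y, hy, ⟨z, hzx, hzy⟩, hle⟩ := hcov x hx
      have hle : n x ≤ 2 * n y := by exact_mod_cast hle
      simp only [Finset.mem_biUnion, Set.Finite.mem_toFinset, Fintype.mem_piFinset,
        Finset.mem_Ico]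
      refine ⟨y, hy, fun i => ?_⟩
      have h1 := mem_shiftedCube.1 hzx i
      have h2 := mem_shiftedCube.1 hzy i
      omega
    calc X.card ≤ ∑ y ∈ hufin.toFinset,
          (Fintype.piFinset fun i => Finset.Ico (y i - 2 * n y) (y i + n y)).card :=
          (Finset.card_le_card hsub).trans Finset.card_biUnion_le
      _ ≤ ∑ y ∈ hufin.toFinset, 3 ^ d * n y ^ d := by
          refine Finset.sum_le_sum fun y _ => ?_
          rw [Fintype.card_piFinset, ← mul_pow]
          calc _ ≤ ∏ _i : Fin d, 3 * n y := by
                refine Finset.prod_le_prod' fun i _ => ?_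
                rw [Nat.card_Ico]
                omega
            _ = _ := by simp
      _ = _ := by rw [Finset.mul_sum]

end Cubes

section MaximalInequality

variable {d : ℕ} {Ω : Type*}

/-- `h` is superadditive, up to a volume error `K`, on disjoint families of cubes in `S_L`. -/
def CubeSuperadditive (τ : (Fin d → ℕ) → Ω → Ω) (h : ℕ → Ω → ℝ) (K : Ω → ℝ) : Prop :=
  ∀ (L : ℕ) (Y : Finset (Fin d → ℕ)) (n : (Fin d → ℕ) → ℕ), 0 < L → (∀ y ∈ Y, 0 < n y) →
    (∀ y ∈ Y, shiftedCube y (n y) ⊆ cubeN d L) →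
    (Y : Set (Fin d → ℕ)).PairwiseDisjoint (fun y => shiftedCube y (n y)) →
    ∀ ω, ∑ y ∈ Y, h (n y) (τ y ω) ≤ h L ω + K ω * (L : ℝ) ^ d

/-- The pointwise covering estimate behind the maximal inequality. -/
lemma CubeSuperadditive.card_le {τ : (Fin d → ℕ) → Ω → Ω} {h : ℕ → Ω → ℝ} {K : Ω → ℝ}
    (hh : CubeSuperadditive τ h K) {α : ℝ} (hα : 0 ≤ α) (N L : ℕ) (hL : 0 < L) (ω : Ω) :
    α * ∑ x ∈ cubeN d (L - N),
      Set.indicator {ω | ∃ n : ℕ, 0 < n ∧ n ≤ N ∧ α * (n : ℝ) ^ d < h n ω} (fun _ => (1 : ℝ)) (τ x ω)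
      ≤ 3 ^ d * (h L ω + K ω * (L : ℝ) ^ d) := by
  classical
  set E : Set Ω := {ω | ∃ n : ℕ, 0 < n ∧ n ≤ N ∧ α * (n : ℝ) ^ d < h n ω} with hE
  set X := (cubeN d (L - N)).filter fun x => τ x ω ∈ E with hX
  have hXmem : ∀ x ∈ X, ∃ n : ℕ, 0 < n ∧ n ≤ N ∧ α * (n : ℝ) ^ d < h n (τ x ω) :=
    fun x hx => (Finset.mem_filter.1 hx).2
  choose! n hn hnN hnh using hXmem
  obtain ⟨Y, hYX, hdisj, hcard⟩ := exists_disjoint_shiftedCubes X n hn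
  have hsum : ∑ x ∈ cubeN d (L - N), E.indicator (fun _ => (1 : ℝ)) (τ x ω) = X.card := by
    rw [hX, Finset.card_filter]
    push_cast
    exact Finset.sum_congr rfl fun x _ => by simp [Set.indicator_apply]
  have hsuper := hh L Y n hL (fun y hy => hn y (hYX hy)) (fun y hy z hz => by
    have h1 := mem_cubeN.1 (Finset.mem_filter.1 (hYX hy)).1
    have h2 := hnN y (hYX hy)
    refine mem_cubeN.2 fun i => ?_
    have h3 := h1 i
    have h4 := mem_shiftedCube.1 hz i
    omega) hdisj ω
  rw [hsum]
  have hcard' : (X.card : ℝ) ≤ 3 ^ d * ∑ y ∈ Y, (n y : ℝ) ^ d := by exact_mod_cast hcard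
  calc α * (X.card : ℝ) ≤ α * (3 ^ d * ∑ y ∈ Y, (n y : ℝ) ^ d) := by gcongr
    _ = 3 ^ d * ∑ y ∈ Y, α * (n y : ℝ) ^ d := by rw [← Finset.mul_sum]; ring
    _ ≤ 3 ^ d * ∑ y ∈ Y, h (n y) (τ y ω) := by
        gcongr with y hy
        exact (hnh y (hYX hy)).le
    _ ≤ _ := by gcongr

lemma tendsto_sub_div_pow (N d : ℕ) :
    Tendsto (fun L : ℕ => ((L - N : ℕ) : ℝ) ^ d / (L : ℝ) ^ d) atTop (nhds 1) := by
  have h1 : Tendsto (fun L : ℕ => 1 - (N : ℝ) / L) atTop (nhds 1) := by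
    simpa using (tendsto_const_div_atTop_nhds_zero_nat (N : ℝ)).const_sub 1
  have h2 := h1.pow d
  rw [one_pow] at h2
  refine h2.congr' ?_
  filter_upwards [eventually_ge_atTop N, eventually_gt_atTop 0] with L hL hL0
  have : (L : ℝ) ≠ 0 := by positivity
  rw [← div_pow, Nat.cast_sub hL, sub_div, div_self this]

variable [MeasurableSpace Ω] {μ : Measure Ω}

/-- The maximal inequality for processes superadditive over disjoint cubes. -/
lemma CubeSuperadditive.maximal [IsFiniteMeasure μ] {τ : (Fin d → ℕ) → Ω → Ω}
    (hτ : ∀ u, MeasurePreserving (τ u) μ μ) {h : ℕ → Ω → ℝ} {K : Ω → ℝ}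
    (hh : CubeSuperadditive τ h K) (h_int : ∀ n, 0 < n → Integrable (h n) μ)
    (hK : Integrable K μ) {c : ℝ} (hc : ∀ᶠ L : ℕ in atTop, ∫ ω, h L ω ∂μ ≤ c * (L : ℝ) ^ d)
    {α : ℝ} (hα : 0 ≤ α) :
    α * μ.real {ω | ∃ n : ℕ, 0 < n ∧ α * (n : ℝ) ^ d < h n ω} ≤ 3 ^ d * (c + ∫ ω, K ω ∂μ) := by
  set E : ℕ → Set Ω := fun N => {ω | ∃ n : ℕ, 0 < n ∧ n ≤ N ∧ α * (n : ℝ) ^ d < h n ω} with hE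
  have hEmeas : ∀ N, NullMeasurableSet (E N) μ := by
    intro N
    have : E N = ⋃ n ∈ Finset.Ioc 0 N, {ω | α * (n : ℝ) ^ d < h n ω} := by
      ext ω; simp [hE, and_assoc]
    rw [this]
    refine Finset.nullMeasurableSet_biUnion _ fun n hn => ?_
    exact nullMeasurableSet_lt aemeasurable_const
      (h_int n (Finset.mem_Ioc.1 hn).1).aestronglyMeasurable.aemeasurable
  have hEN : ∀ N, α * μ.real (E N) ≤ 3 ^ d * (c + ∫ ω, K ω ∂μ) := by
    intro N
    have hmain : ∀ᶠ L : ℕ in atTop, α * μ.real (E N) * (((L - N : ℕ) : ℝ) ^ d / (L : ℝ) ^ d)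
        ≤ 3 ^ d * (c + ∫ ω, K ω ∂μ) := by
      filter_upwards [hc, eventually_gt_atTop 0] with L hcL hL
      have hind : ∀ x, Integrable
          (fun ω => (E N).indicator (fun _ => (1 : ℝ)) (τ x ω)) μ := fun x =>
        (hτ x).integrable_comp_of_integrable
          ((integrable_const (1 : ℝ)).indicator₀ (hEmeas N))
      have hind' : ∀ x, ∫ ω, (E N).indicator (fun _ => (1 : ℝ)) (τ x ω) ∂μ = μ.real (E N) := by
        intro x
        have : (fun ω => (E N).indicator (fun _ => (1 : ℝ)) (τ x ω))
            = (τ x ⁻¹' E N).indicator (fun _ => (1 : ℝ)) := rfl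
        rw [this, integral_indicator₀ ((hEmeas N).preimage (hτ x).quasiMeasurePreserving)]
        simp [Measure.real, (hτ x).measure_preimage (hEmeas N)]
      have hI := integral_mono (μ := μ)
        ((integrable_finsetSum (cubeN d (L - N)) fun x _ => hind x).const_mul α)
        (((h_int L hL).add (hK.mul_const ((L : ℝ) ^ d))).const_mul (3 ^ d : ℝ))
        (fun ω => hh.card_le hα N L hL ω)
      rw [integral_const_mul, integral_finsetSum _ fun x _ => hind x, integral_const_mul] at hI
      simp only [Pi.add_apply] at hI
      rw [integral_add (h_int L hL) (hK.mul_const _), integral_mul_const] at hI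
      simp only [hind', Finset.sum_const, card_cubeN, nsmul_eq_mul, Nat.cast_pow] at hI
      have hLd : (0 : ℝ) < (L : ℝ) ^ d := by positivity
      rw [← mul_div_assoc, div_le_iff₀ hLd]
      have h3 : (3 : ℝ) ^ d * (∫ ω, h L ω ∂μ + (∫ ω, K ω ∂μ) * (L : ℝ) ^ d)
          ≤ 3 ^ d * (c * (L : ℝ) ^ d + (∫ ω, K ω ∂μ) * (L : ℝ) ^ d) := by gcongr
      linarith
    have hlim := (tendsto_sub_div_pow N d).const_mul (α * μ.real (E N))
    rw [mul_one] at hlim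
    exact le_of_tendsto hlim hmain
  have hunion : {ω | ∃ n : ℕ, 0 < n ∧ α * (n : ℝ) ^ d < h n ω} = ⋃ N, E N := by
    ext ω
    simp only [hE, Set.mem_ofPred_eq, Set.mem_iUnion]
    exact ⟨fun ⟨n, h0, h1⟩ => ⟨n, n, h0, le_rfl, h1⟩, fun ⟨_, n, h0, _, h1⟩ => ⟨n, h0, h1⟩⟩
  have hmono : Monotone E := fun a b hab ω ⟨n, h0, h1, h2⟩ => ⟨n, h0, h1.trans hab, h2⟩
  have hlim : Tendsto (fun N => μ.real (E N)) atTop (nhds (μ.real (⋃ N, E N))) :=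
    (ENNReal.tendsto_toReal (measure_ne_top _ _)).comp (tendsto_measure_iUnion_atTop hmono)
  rw [hunion]
  exact le_of_tendsto (hlim.const_mul α) (Eventually.of_forall hEN)

/-- A sequence of functions whose oscillation at infinity is small off sets of small measure
converges almost everywhere. -/
lemma ae_exists_tendsto_of_small_oscillation {a : ℕ → Ω → ℝ}
    (h : ∀ ε > 0, ∃ E : Set Ω, μ E ≤ ENNReal.ofReal ε ∧
      ∀ᵐ ω ∂μ, ω ∉ E → ∃ N, ∀ n ≥ N, ∀ k ≥ N, |a n ω - a k ω| ≤ ε) :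
    ∀ᵐ ω ∂μ, ∃ L, Tendsto (fun n => a n ω) atTop (nhds L) := by
  have hosc : ∀ j : ℕ, ∀ᵐ ω ∂μ,
      ∃ N, ∀ n ≥ N, ∀ k ≥ N, |a n ω - a k ω| ≤ 1 / ((j : ℝ) + 1) := by
    intro j
    rw [ae_iff]
    refine le_antisymm (ENNReal.le_of_forall_pos_le_add fun ε hε _ => ?_) bot_le
    obtain ⟨E, hE, hae⟩ := h (min ε (1 / ((j : ℝ) + 1))) (by positivity)
    rw [ae_iff] at hae
    calc μ {ω | ¬∃ N, ∀ n ≥ N, ∀ k ≥ N, |a n ω - a k ω| ≤ 1 / ((j : ℝ) + 1)}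
        ≤ μ (E ∪ {ω | ¬(ω ∉ E → ∃ N, ∀ n ≥ N, ∀ k ≥ N,
            |a n ω - a k ω| ≤ min (ε : ℝ) (1 / ((j : ℝ) + 1)))}) := by
          refine measure_mono fun ω hω => ?_
          by_cases hωE : ω ∈ E
          · exact Or.inl hωE
          · refine Or.inr fun hcon => hω ?_
            obtain ⟨N, hN⟩ := hcon hωE
            exact ⟨N, fun n hn k hk => (hN n hn k hk).trans (min_le_right _ _)⟩
      _ ≤ μ E + 0 := (measure_union_le _ _).trans (by rw [hae])
      _ ≤ 0 + ε := by
          rw [add_zero, zero_add]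
          refine hE.trans ?_
          rw [← ENNReal.ofReal_coe_nnreal]
          exact ENNReal.ofReal_le_ofReal (min_le_left _ _)
  filter_upwards [ae_all_iff.2 hosc] with ω hω
  refine cauchySeq_tendsto_of_complete (Metric.cauchySeq_iff.2 fun ε hε => ?_)
  obtain ⟨j, hj⟩ := exists_nat_one_div_lt hε
  obtain ⟨N, hN⟩ := hω j
  exact ⟨N, fun n hn k hk => (Real.dist_eq _ _).trans_lt ((hN n hn k hk).trans_lt hj)⟩

end MaximalInequality

section PointwiseErgodic

variable {d : ℕ} {Ω : Type*}

/-- The average of `f` along the orbit of `ω` over the cube `S_n`. -/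
noncomputable def cubeAverage (τ : (Fin d → ℕ) → Ω → Ω) (f : Ω → ℝ) (n : ℕ) (ω : Ω) : ℝ :=
  (∑ x ∈ cubeN d n, f (τ x ω)) / (n : ℝ) ^ d

lemma sum_cubeN_comp {τ : (Fin d → ℕ) → Ω → Ω} (hadd : ∀ u v, τ (u + v) = τ u ∘ τ v)
    (f : Ω → ℝ) (y : Fin d → ℕ) (n : ℕ) (ω : Ω) :
    ∑ x ∈ cubeN d n, f (τ x (τ y ω)) = ∑ z ∈ shiftedCube y n, f (τ z ω) := by
  rw [← image_add_cubeN, Finset.sum_image fun a _ b _ h => add_left_cancel h]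
  refine Finset.sum_congr rfl fun x _ => ?_
  rw [add_comm, hadd, Function.comp_apply]

lemma cubeSuperadditive_sum {τ : (Fin d → ℕ) → Ω → Ω} (hadd : ∀ u v, τ (u + v) = τ u ∘ τ v)
    {g : Ω → ℝ} (hg : ∀ ω, 0 ≤ g ω) :
    CubeSuperadditive τ (fun n ω => ∑ x ∈ cubeN d n, g (τ x ω)) (fun _ => 0) := by
  intro L Y n _ _ hsub hdisj ω
  simp only [sum_cubeN_comp hadd, zero_mul, add_zero]
  rw [← Finset.sum_biUnion hdisj]
  exact Finset.sum_le_sum_of_subset_of_nonneg (Finset.biUnion_subset.2 hsub) fun _ _ _ => hg _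

lemma cubeAverage_add (τ : (Fin d → ℕ) → Ω → Ω) (f g : Ω → ℝ) (n : ℕ) (ω : Ω) :
    cubeAverage τ (fun ω => f ω + g ω) n ω = cubeAverage τ f n ω + cubeAverage τ g n ω := by
  simp [cubeAverage, Finset.sum_add_distrib, add_div]

lemma cubeAverage_const_mul (τ : (Fin d → ℕ) → Ω → Ω) (c : ℝ) (f : Ω → ℝ) (n : ℕ) (ω : Ω) :
    cubeAverage τ (fun ω => c * f ω) n ω = c * cubeAverage τ f n ω := by
  simp [cubeAverage, ← Finset.mul_sum, mul_div_assoc]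

/-- For bounded functions, averaging forgets a shift. -/
lemma tendsto_cubeAverage_sub_comp {τ : (Fin d → ℕ) → Ω → Ω}
    (hadd : ∀ u v, τ (u + v) = τ u ∘ τ v) {f : Ω → ℝ} {C : ℝ} (hf : ∀ ω, |f ω| ≤ C)
    (u : Fin d → ℕ) (ω : Ω) :
    Tendsto (fun n => cubeAverage τ (fun ω => f ω - f (τ u ω)) n ω) atTop (nhds 0) := by
  classical
  set M := ∑ i, u i with hM
  have hbound : ∀ n : ℕ, 0 < n → |cubeAverage τ (fun ω => f ω - f (τ u ω)) n ω|
      ≤ 2 * C * (1 - ((n - M : ℕ) : ℝ) ^ d / (n : ℝ) ^ d) := by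
    intro n hn
    have hnd : (0 : ℝ) < (n : ℝ) ^ d := by positivity
    have hsum : ∑ x ∈ cubeN d n, f (τ u (τ x ω)) = ∑ z ∈ shiftedCube u n, f (τ z ω) := by
      rw [← sum_cubeN_comp hadd]
      refine Finset.sum_congr rfl fun x _ => ?_
      rw [← Function.comp_apply (f := τ u), ← hadd, add_comm, hadd, Function.comp_apply]
    have hinter : shiftedCube u (n - M) ⊆ cubeN d n ∩ shiftedCube u n := by
      intro x hx
      rw [mem_shiftedCube] at hx
      rw [Finset.mem_inter, mem_cubeN, mem_shiftedCube]
      have hu : ∀ i, u i ≤ M := fun i =>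
        Finset.single_le_sum (f := u) (fun _ _ => Nat.zero_le _) (Finset.mem_univ i)
      constructor <;> intro i <;> have := hx i <;> have := hu i <;> omega
    have hcard := Finset.card_le_card hinter
    rw [card_shiftedCube] at hcard
    have hdiff : ∀ S T : Finset (Fin d → ℕ), S.card = n ^ d → S ∩ T = cubeN d n ∩ shiftedCube u n →
        |∑ x ∈ S \ T, f (τ x ω)| ≤ C * ((n : ℝ) ^ d - ((n - M : ℕ) : ℝ) ^ d) := by
      intro S T hS hST
      have hC : 0 ≤ C := (abs_nonneg _).trans (hf ω)
      have h1 : ((S \ T).card : ℝ) ≤ (n : ℝ) ^ d - ((n - M : ℕ) : ℝ) ^ d := by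
        have h2 := Finset.card_sdiff_add_card_inter S T
        rw [hS, hST] at h2
        have h3 : (S \ T).card + (n - M) ^ d ≤ n ^ d := by omega
        rw [le_sub_iff_add_le]
        exact_mod_cast h3
      calc |∑ x ∈ S \ T, f (τ x ω)| ≤ ∑ x ∈ S \ T, |f (τ x ω)| := Finset.abs_sum_le_sum_abs _ _
        _ ≤ (S \ T).card * C := by
            simpa using Finset.sum_le_card_nsmul (S \ T) _ C fun x _ => hf (τ x ω)
        _ ≤ _ := by rw [mul_comm]; gcongr
    have h1 := hdiff (cubeN d n) (shiftedCube u n) (card_cubeN n) rfl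
    have h2 := hdiff (shiftedCube u n) (cubeN d n) (card_shiftedCube u n) (Finset.inter_comm _ _)
    rw [cubeAverage, Finset.sum_sub_distrib, hsum, ← Finset.sum_sdiff_sub_sum_sdiff, abs_div,
      abs_of_pos hnd, div_le_iff₀ hnd]
    have h3 : 2 * C * (1 - ((n - M : ℕ) : ℝ) ^ d / (n : ℝ) ^ d) * (n : ℝ) ^ d
        = 2 * (C * ((n : ℝ) ^ d - ((n - M : ℕ) : ℝ) ^ d)) := by field_simp
    rw [h3]
    exact (abs_sub _ _).trans (by linarith)
  refine squeeze_zero_norm' (a := fun n : ℕ => 2 * C * (1 - ((n - M : ℕ) : ℝ) ^ d / (n : ℝ) ^ d))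
    ?_ ?_
  · filter_upwards [eventually_gt_atTop 0] with n hn using hbound n hn
  · simpa using ((tendsto_sub_div_pow M d).const_sub 1).const_mul (2 * C)

variable [MeasurableSpace Ω] {μ : Measure Ω}

lemma integral_comp_of_measurePreserving {T : Ω → Ω} (hT : MeasurePreserving T μ μ) {f : Ω → ℝ}
    (hf : Integrable f μ) : ∫ ω, f (T ω) ∂μ = ∫ ω, f ω ∂μ := by
  have h := integral_map hT.aemeasurable (f := f)
    (by rw [hT.map_eq]; exact hf.aestronglyMeasurable)
  rw [← h, hT.map_eq]

/-- The averages of `f` over the cubes `S_n` converge almost everywhere. -/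
def CubeAverageConverges (μ : Measure Ω) (τ : (Fin d → ℕ) → Ω → Ω) (f : Ω → ℝ) : Prop :=
  ∀ᵐ ω ∂μ, ∃ L, Tendsto (fun n => cubeAverage τ f n ω) atTop (nhds L)

namespace CubeAverageConverges

variable {τ : (Fin d → ℕ) → Ω → Ω} {f g : Ω → ℝ}

lemma add (hf : CubeAverageConverges μ τ f) (hg : CubeAverageConverges μ τ g) :
    CubeAverageConverges μ τ (fun ω => f ω + g ω) := by
  filter_upwards [hf, hg] with ω ⟨a, ha⟩ ⟨b, hb⟩
  exact ⟨a + b, by simpa only [cubeAverage_add] using ha.add hb⟩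

lemma const_mul (hf : CubeAverageConverges μ τ f) (c : ℝ) :
    CubeAverageConverges μ τ (fun ω => c * f ω) := by
  filter_upwards [hf] with ω ⟨a, ha⟩
  exact ⟨c * a, by simpa only [cubeAverage_const_mul] using ha.const_mul c⟩

lemma congr (hτ : ∀ u, MeasurePreserving (τ u) μ μ) (hf : CubeAverageConverges μ τ f)
    (hfg : f =ᵐ[μ] g) : CubeAverageConverges μ τ g := by
  have h : ∀ᵐ ω ∂μ, ∀ u, f (τ u ω) = g (τ u ω) :=
    ae_all_iff.2 fun u => (hτ u).quasiMeasurePreserving.ae hfg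
  filter_upwards [hf, h] with ω ⟨a, ha⟩ h
  exact ⟨a, by simpa only [cubeAverage, h] using ha⟩

lemma of_invariant (h : ∀ u, ∀ᵐ ω ∂μ, f (τ u ω) = f ω) : CubeAverageConverges μ τ f := by
  filter_upwards [ae_all_iff.2 h] with ω h
  refine ⟨f ω, tendsto_const_nhds.congr' ?_⟩
  filter_upwards [eventually_gt_atTop 0] with n hn
  have : (n : ℝ) ^ d ≠ 0 := by positivity
  simp [cubeAverage, h, card_cubeN, this]

/-- By the maximal inequality, convergence of averages is a closed condition in `L¹`. -/
lemma of_approx [IsFiniteMeasure μ] (hτ : ∀ u, MeasurePreserving (τ u) μ μ)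
    (hadd : ∀ u v, τ (u + v) = τ u ∘ τ v) (hf : Integrable f μ)
    (h : ∀ δ > 0, ∃ g, Integrable g μ ∧ CubeAverageConverges μ τ g ∧ ∫ ω, |f ω - g ω| ∂μ ≤ δ) :
    CubeAverageConverges μ τ f := by
  refine ae_exists_tendsto_of_small_oscillation fun ε hε => ?_
  obtain ⟨g, hg, hgconv, hfg⟩ := h (ε / 3 * ε / 3 ^ d) (by positivity)
  set D : Ω → ℝ := fun ω => |f ω - g ω| with hD
  have hDint : Integrable D μ := (hf.sub hg).abs
  have hDcomp : ∀ x, Integrable (fun ω => D (τ x ω)) μ := fun x =>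
    (hτ x).integrable_comp_of_integrable hDint
  have hmax := (cubeSuperadditive_sum (τ := τ) hadd (g := D) fun _ => abs_nonneg _).maximal
    (μ := μ) (c := ∫ ω, D ω ∂μ) hτ (fun n _ => integrable_finsetSum _ fun x _ => hDcomp x)
    (integrable_zero _ _ _) (Eventually.of_forall fun L => by
      rw [integral_finsetSum _ fun x _ => hDcomp x]
      simp [integral_comp_of_measurePreserving (hτ _) hDint, card_cubeN, mul_comm])
    (α := ε / 3) (by positivity)
  refine ⟨{ω | ∃ n : ℕ, 0 < n ∧ ε / 3 * (n : ℝ) ^ d < ∑ x ∈ cubeN d n, D (τ x ω)}, ?_, ?_⟩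
  · rw [← ofReal_measureReal]
    refine ENNReal.ofReal_le_ofReal ?_
    simp only [integral_zero, add_zero] at hmax
    have h3 : (3 : ℝ) ^ d * ∫ ω, D ω ∂μ ≤ ε / 3 * ε := by
      rw [mul_comm, ← le_div_iff₀ (by positivity)]
      exact hfg
    exact le_of_mul_le_mul_left (hmax.trans h3) (by positivity)
  · filter_upwards [hgconv] with ω ⟨L, hL⟩ hω
    obtain ⟨N, hN⟩ := Metric.cauchySeq_iff.1 hL.cauchySeq (ε / 3) (by positivity)
    have hclose : ∀ n, 0 < n → |cubeAverage τ f n ω - cubeAverage τ g n ω| ≤ ε / 3 := by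
      intro n hn
      have hnd : (0 : ℝ) < (n : ℝ) ^ d := by positivity
      rw [cubeAverage, cubeAverage, ← sub_div, ← Finset.sum_sub_distrib, abs_div, abs_of_pos hnd,
        div_le_iff₀ hnd]
      refine (Finset.abs_sum_le_sum_abs _ _).trans ?_
      by_contra hcon
      exact hω ⟨n, hn, not_le.1 hcon⟩
    refine ⟨N + 1, fun n hn k hk => ?_⟩
    have h1 := abs_le.1 (hclose n (by omega))
    have h2 := abs_le.1 (hclose k (by omega))
    have h3 := abs_lt.1 (Real.dist_eq _ _ ▸ hN n (by omega) k (by omega))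
    rw [abs_le]
    constructor <;> linarith [h1.1, h1.2, h2.1, h2.2, h3.1, h3.2]

end CubeAverageConverges

/-- In a Hilbert space, the closed convex hull of an orbit of a commutative semigroup of linear
isometries contains a fixed point. -/
lemma exists_fixedPoint_mem_closure_convexHull {H : Type*} [NormedAddCommGroup H]
    [InnerProductSpace ℝ H] [CompleteSpace H] {ι : Type*} [AddCommSemigroup ι] [Nonempty ι]
    (U : ι → H →ₗᵢ[ℝ] H) (hU : ∀ u v x, U (u + v) x = U u (U v x)) (x : H) :
    ∃ p ∈ closure (convexHull ℝ (Set.range fun u => U u x)), ∀ u, U u p = p := by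
  set C := closure (convexHull ℝ (Set.range fun u => U u x)) with hC
  have hconv : Convex ℝ C := (convex_convexHull ℝ _).closure
  obtain ⟨p, hp, hpmin⟩ := exists_norm_eq_iInf_of_complete_convex
    ((Set.range_nonempty _).mono ((subset_convexHull ℝ _).trans subset_closure))
    isClosed_closure.isComplete hconv (0 : H)
  rw [norm_eq_iInf_iff_real_inner_le_zero hconv hp] at hpmin
  refine ⟨p, hp, fun u => ?_⟩
  have hmem : U u p ∈ C := by
    have hmaps : Set.MapsTo (U u) (convexHull ℝ (Set.range fun u => U u x))
        (convexHull ℝ (Set.range fun u => U u x)) := by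
      rw [Set.mapsTo_iff_image_subset]
      change (U u).toLinearMap '' _ ⊆ _
      rw [LinearMap.image_convexHull]
      refine convexHull_mono ?_
      rintro _ ⟨_, ⟨v, rfl⟩, rfl⟩
      exact ⟨u + v, hU u v x⟩
    exact hmaps.closure (U u).continuous hp
  have h1 := hpmin _ hmem
  rw [zero_sub, inner_neg_left, inner_sub_right, real_inner_self_eq_norm_sq] at h1
  have h2 := norm_sub_sq_real (U u p) p
  rw [LinearIsometry.norm_map, real_inner_comm] at h2
  have h3 : ‖U u p - p‖ ^ 2 ≤ 0 := by linarith
  have h4 : ‖U u p - p‖ = 0 := by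
    have := sq_nonneg ‖U u p - p‖
    exact pow_eq_zero_iff (two_ne_zero) |>.1 (le_antisymm h3 this)
  exact sub_eq_zero.1 (norm_eq_zero.1 h4)

end PointwiseErgodic

section PointwiseErgodicTheorem

variable {d : ℕ} {Ω : Type*} [MeasurableSpace Ω] {μ : Measure Ω}

lemma integral_abs_le_of_eLpNorm_one_le {f : Ω → ℝ} (hf : AEStronglyMeasurable f μ) {δ : ℝ}
    (hδ : 0 ≤ δ) (h : eLpNorm f 1 μ ≤ ENNReal.ofReal δ) : ∫ ω, |f ω| ∂μ ≤ δ := by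
  have h1 := integral_norm_eq_lintegral_enorm hf
  rw [← eLpNorm_one_eq_lintegral_enorm] at h1
  simp only [Real.norm_eq_abs] at h1
  rw [h1]
  exact ENNReal.toReal_le_of_le_ofReal hδ h

lemma CubeAverageConverges.of_bounded [IsProbabilityMeasure μ] {τ : (Fin d → ℕ) → Ω → Ω}
    (hτ : ∀ u, MeasurePreserving (τ u) μ μ) (hadd : ∀ u v, τ (u + v) = τ u ∘ τ v) {f : Ω → ℝ}
    (hf : AEStronglyMeasurable f μ) {C : ℝ} (hC : ∀ ω, |f ω| ≤ C) :
    CubeAverageConverges μ τ f := by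
  have hf2 : MemLp f 2 μ := MemLp.of_bound hf C (Eventually.of_forall hC)
  let U : (Fin d → ℕ) → Lp ℝ 2 μ →ₗᵢ[ℝ] Lp ℝ 2 μ := fun u =>
    Lp.compMeasurePreservingₗᵢ ℝ (τ u) (hτ u)
  have hUcoe : ∀ u (g : Lp ℝ 2 μ), U u g =ᵐ[μ] fun ω => g (τ u ω) := fun u g =>
    Lp.coeFn_compMeasurePreserving g (hτ u)
  have hU : ∀ u v (g : Lp ℝ 2 μ), U (u + v) g = U u (U v g) := by
    intro u v g
    apply Lp.ext
    filter_upwards [hUcoe (u + v) g, hUcoe u (U v g),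
      (hτ u).quasiMeasurePreserving.ae (hUcoe v g)] with ω h1 h2 h3
    rw [h1, h2, h3, add_comm, hadd, Function.comp_apply]
  obtain ⟨p, hp, hpU⟩ := exists_fixedPoint_mem_closure_convexHull U hU (hf2.toLp f)
  have hpinv : CubeAverageConverges μ τ p := of_invariant fun u => by
    have h := hUcoe u p
    rw [hpU u] at h
    filter_upwards [h] with ω h using h.symm
  have hhull : convexHull ℝ (Set.range fun u => U u (hf2.toLp f)) ⊆
      {g : Lp ℝ 2 μ | CubeAverageConverges μ τ fun ω => f ω - g ω} := by
    refine convexHull_min ?_ ?_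
    · rintro _ ⟨u, rfl⟩
      have h0 : CubeAverageConverges μ τ fun ω => f ω - f (τ u ω) :=
        Eventually.of_forall fun ω => ⟨0, tendsto_cubeAverage_sub_comp hadd hC u ω⟩
      refine h0.congr hτ ?_
      filter_upwards [hUcoe u (hf2.toLp f),
        (hτ u).quasiMeasurePreserving.ae hf2.coeFn_toLp] with ω h1 h2
      rw [h1, h2]
    · intro g₁ h₁ g₂ h₂ a b _ _ hab
      refine ((h₁.const_mul a).add (h₂.const_mul b)).congr hτ ?_
      filter_upwards [Lp.coeFn_add (a • g₁) (b • g₂), Lp.coeFn_smul a g₁, Lp.coeFn_smul b g₂]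
        with ω e1 e2 e3
      rw [e1, Pi.add_apply, e2, e3, Pi.smul_apply, Pi.smul_apply, smul_eq_mul, smul_eq_mul]
      linear_combination f ω * hab
  have h_int : ∀ g : Lp ℝ 2 μ, Integrable g μ := fun g => (Lp.memLp g).integrable (by norm_num)
  have hfint : Integrable f μ := hf2.integrable (by norm_num)
  refine of_approx hτ hadd hfint fun δ hδ => ?_
  obtain ⟨g, hg, hgp⟩ := Metric.mem_closure_iff.1 hp δ hδ
  have hconv : CubeAverageConverges μ τ fun ω => f ω - g ω := hhull hg
  refine ⟨fun ω => (f ω - g ω) + p ω, (hfint.sub (h_int g)).add (h_int p), hconv.add hpinv, ?_⟩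
  have hsub : ∀ ω, f ω - (f ω - g ω + p ω) = (⇑g - ⇑p) ω := fun ω => by
    rw [Pi.sub_apply]; ring
  simp only [hsub]
  have haesm := ((h_int g).sub (h_int p)).aestronglyMeasurable
  refine integral_abs_le_of_eLpNorm_one_le haesm hδ.le ?_
  refine (eLpNorm_le_eLpNorm_of_exponent_le (q := 2) (by norm_num) haesm).trans ?_
  rw [← eLpNorm_congr_ae (Lp.coeFn_sub g p), ← Lp.enorm_def, ← ofReal_norm]
  refine ENNReal.ofReal_le_ofReal ?_
  rw [← dist_eq_norm, dist_comm]
  exact hgp.le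

/-- The pointwise ergodic theorem for cube averages of a `d`-parameter semigroup. -/
theorem CubeAverageConverges.of_integrable [IsProbabilityMeasure μ] {τ : (Fin d → ℕ) → Ω → Ω}
    (hτ : ∀ u, MeasurePreserving (τ u) μ μ) (hadd : ∀ u v, τ (u + v) = τ u ∘ τ v) {f : Ω → ℝ}
    (hf : Integrable f μ) : CubeAverageConverges μ τ f := by
  refine of_approx hτ hadd hf fun δ hδ => ?_
  obtain ⟨g, hg, hgL⟩ := (memLp_one_iff_integrable.2 hf).exists_simpleFunc_eLpNorm_sub_lt
    ENNReal.one_ne_top (ε := ENNReal.ofReal δ) (by simpa using hδ)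
  obtain ⟨C, hC⟩ := g.exists_forall_norm_le
  exact ⟨g, memLp_one_iff_integrable.1 hgL,
    of_bounded hτ hadd g.aestronglyMeasurable hC,
    integral_abs_le_of_eLpNorm_one_le (f := f - ⇑g)
      (hf.aestronglyMeasurable.sub g.aestronglyMeasurable) hδ.le hg.le⟩

end PointwiseErgodicTheorem

section BlockExcess

variable {d : ℕ} {Ω : Type*}

/-- The excess of `F` on the cube of side `n * m` over the sum of its values on the translated
blocks of side `m`. -/
noncomputable def blockExcess (τ : (Fin d → ℕ) → Ω → Ω) (F : Finset (Fin d → ℕ) → Ω → ℝ)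
    (m n : ℕ) (ω : Ω) : ℝ :=
  F (cubeN d (n * m)) ω - ∑ x ∈ cubeN d n, F (cubeN d m) (τ (m • x) ω)

lemma mem_shiftedCube_smul {m : ℕ} (hm : 0 < m) {w p : Fin d → ℕ} {n : ℕ} :
    p ∈ shiftedCube (m • w) (n * m) ↔ (fun i => p i / m) ∈ shiftedCube w n := by
  simp only [mem_shiftedCube, Pi.smul_apply, smul_eq_mul]
  refine forall_congr' fun i => ?_
  rw [Nat.le_div_iff_mul_le hm, Nat.div_lt_iff_lt_mul hm, add_mul, mul_comm m (w i)]

lemma mem_cubeN_mul {m : ℕ} (hm : 0 < m) {p : Fin d → ℕ} {n : ℕ} :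
    p ∈ cubeN d (n * m) ↔ (fun i => p i / m) ∈ cubeN d n := by
  simp only [mem_cubeN]
  exact forall_congr' fun i => (Nat.div_lt_iff_lt_mul hm).symm

lemma shiftedCube_one (w : Fin d → ℕ) : shiftedCube w 1 = {w} := by
  ext x
  rw [mem_shiftedCube, Finset.mem_singleton, funext_iff]
  exact forall_congr' fun i => by omega

variable [MeasurableSpace Ω] {μ : Measure Ω} {τ : (Fin d → ℕ) → Ω → Ω}
  {F : Finset (Fin d → ℕ) → Ω → ℝ} {A : Ω → ℝ}

namespace AlmostSuperadditive

lemma superadd_finset (hF : AlmostSuperadditive μ τ F A) {ι : Type*} (s : Finset ι)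
    (Bs : ι → Finset (Fin d → ℕ)) (hbox : ∀ i ∈ s, IsBoxN (Bs i))
    (hdisj : (s : Set ι).PairwiseDisjoint Bs) {B : Finset (Fin d → ℕ)} (hB : IsBoxN B)
    (hunion : ∀ p, p ∈ B ↔ ∃ i ∈ s, p ∈ Bs i) (ω : Ω) :
    ∑ i ∈ s, F (Bs i) ω - A ω * ∑ i ∈ s, ((ibdN (Bs i)).card : ℝ) ≤ F B ω := by
  have hU : Finset.univ.biUnion (fun i => Bs (s.equivFin.symm i : ι)) = B := by
    ext p
    simp only [Finset.mem_biUnion, Finset.mem_univ, true_and, hunion]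
    constructor
    · rintro ⟨i, hi⟩
      exact ⟨_, (s.equivFin.symm i).2, hi⟩
    · rintro ⟨i, hi, hp⟩
      exact ⟨s.equivFin ⟨i, hi⟩, by simpa using hp⟩
  have h := hF.superadd s.card (fun i => Bs (s.equivFin.symm i : ι))
    (fun i => hbox _ (s.equivFin.symm i).2)
    (fun i j hij => hdisj (s.equivFin.symm i).2 (s.equivFin.symm j).2 fun hcon =>
      hij (s.equivFin.symm.injective (Subtype.ext hcon)))
    (by rw [hU]; exact hB) ω
  rw [hU, Equiv.sum_comp s.equivFin.symm fun i : s => F (Bs i) ω,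
    Equiv.sum_comp s.equivFin.symm fun i : s => ((ibdN (Bs i)).card : ℝ),
    Finset.sum_coe_sort s fun i => F (Bs i) ω,
    Finset.sum_coe_sort s fun i => ((ibdN (Bs i)).card : ℝ)] at h
  exact h

lemma apply_shiftedCube (hF : AlmostSuperadditive μ τ F A) (u : Fin d → ℕ) {n : ℕ} (hn : 0 < n)
    (ω : Ω) : F (shiftedCube u n) ω = F (cubeN d n) (τ u ω) := by
  rw [← image_add_cubeN, hF.shift u _ (isBoxN_cubeN hn), Function.comp_apply]

lemma smul_semigroup (hF : AlmostSuperadditive μ τ F A) (m : ℕ) (u v : Fin d → ℕ) :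
    τ (m • (u + v)) = τ (m • u) ∘ τ (m • v) := by
  rw [smul_add, hF.semigroup]

lemma sum_blockExcess_le (hF : AlmostSuperadditive μ τ F A) {m : ℕ} (hm : 0 < m) {L : ℕ}
    (hL : 0 < L) (Y : Finset (Fin d → ℕ)) (n : (Fin d → ℕ) → ℕ) (hn : ∀ y ∈ Y, 0 < n y)
    (hsub : ∀ y ∈ Y, shiftedCube y (n y) ⊆ cubeN d L)
    (hdisj : (Y : Set (Fin d → ℕ)).PairwiseDisjoint (fun y => shiftedCube y (n y))) (ω : Ω) :
    ∑ y ∈ Y, blockExcess τ F m (n y) (τ (m • y) ω) ≤ blockExcess τ F m L ω +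
      A ω * (2 * d * ((m : ℝ) ^ d / m) *
        (∑ y ∈ Y, (n y : ℝ) ^ d / n y + ((L : ℝ) ^ d - ∑ y ∈ Y, (n y : ℝ) ^ d))) := by
  classical
  set V := Y.biUnion fun y => shiftedCube y (n y) with hV
  have hVsub : V ⊆ cubeN d L := Finset.biUnion_subset.2 hsub
  set Z := cubeN d L \ V with hZ
  have hYZ : Disjoint Y Z := by
    rw [Finset.disjoint_left]
    intro y hy hyZ
    exact (Finset.mem_sdiff.1 hyZ).2
      (Finset.mem_biUnion.2 ⟨y, hy, self_mem_shiftedCube y (hn y hy)⟩)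
  set N : (Fin d → ℕ) → ℕ := fun w => if w ∈ Y then n w else 1 with hN
  have hNY : ∀ y ∈ Y, N y = n y := fun y hy => if_pos hy
  have hNZ : ∀ z ∈ Z, N z = 1 := fun z hz => if_neg (Finset.disjoint_right.1 hYZ hz)
  have hNpos : ∀ w, 0 < N w := by
    intro w
    by_cases hw : w ∈ Y
    · rw [hNY w hw]; exact hn w hw
    · simp [hN, hw]
  have hcases : ∀ w ∈ Y ∪ Z, ∀ q ∈ shiftedCube w (N w),
      (w ∈ Y ∧ q ∈ shiftedCube w (n w)) ∨ (w = q ∧ q ∈ Z) := by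
    intro w hw q hq
    rcases Finset.mem_union.1 hw with hw | hw
    · exact Or.inl ⟨hw, hNY w hw ▸ hq⟩
    · rw [hNZ w hw, shiftedCube_one, Finset.mem_singleton] at hq
      exact Or.inr ⟨hq.symm, hq ▸ hw⟩
  have hZV : ∀ q ∈ Z, ∀ y ∈ Y, q ∉ shiftedCube y (n y) := fun q hq y hy hqy =>
    (Finset.mem_sdiff.1 hq).2 (Finset.mem_biUnion.2 ⟨y, hy, hqy⟩)
  have hsuper := hF.superadd_finset (Y ∪ Z) (fun w => shiftedCube (m • w) (N w * m))
    (fun w _ => isBoxN_shiftedCube _ (Nat.mul_pos (hNpos w) hm))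
    (by
      intro w hw w' hw' hne
      refine Finset.disjoint_left.2 fun p hp hp' => hne ?_
      rw [mem_shiftedCube_smul hm] at hp hp'
      rcases hcases w hw _ hp with ⟨h1, h2⟩ | ⟨h1, h2⟩ <;>
        rcases hcases w' hw' _ hp' with ⟨h3, h4⟩ | ⟨h3, h4⟩
      · by_contra hne
        exact Finset.disjoint_left.1 (hdisj h1 h3 hne) h2 h4
      · exact absurd h2 (hZV _ h4 _ h1)
      · exact absurd h4 (hZV _ h2 _ h3)
      · exact h1.trans h3.symm)
    (isBoxN_cubeN (Nat.mul_pos hL hm))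
    (by
      intro p
      rw [mem_cubeN_mul hm]
      simp only [mem_shiftedCube_smul hm]
      constructor
      · intro hp
        by_cases hpV : (fun i => p i / m) ∈ V
        · obtain ⟨y, hy, hpy⟩ := Finset.mem_biUnion.1 hpV
          exact ⟨y, Finset.mem_union_left _ hy, by rwa [hNY y hy]⟩
        · have hpZ : (fun i => p i / m) ∈ Z := Finset.mem_sdiff.2 ⟨hp, hpV⟩
          exact ⟨_, Finset.mem_union_right _ hpZ, self_mem_shiftedCube _ (hNpos _)⟩
      · rintro ⟨w, hw, hp⟩
        rcases hcases w hw _ hp with ⟨h1, h2⟩ | ⟨_, h2⟩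
        · exact hsub w h1 h2
        · exact (Finset.mem_sdiff.1 h2).1)
    ω
  have hFsum : ∑ w ∈ Y ∪ Z, F (shiftedCube (m • w) (N w * m)) ω =
      ∑ y ∈ Y, F (cubeN d (n y * m)) (τ (m • y) ω) +
        ∑ z ∈ Z, F (cubeN d m) (τ (m • z) ω) := by
    rw [Finset.sum_union hYZ]
    congr 1
    · refine Finset.sum_congr rfl fun y hy => ?_
      rw [hNY y hy, hF.apply_shiftedCube _ (Nat.mul_pos (hn y hy) hm)]
    · refine Finset.sum_congr rfl fun z hz => ?_
      rw [hNZ z hz, one_mul, hF.apply_shiftedCube _ hm]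
  have hcardZ : (Z.card : ℝ) = (L : ℝ) ^ d - ∑ y ∈ Y, (n y : ℝ) ^ d := by
    have h1 := Finset.card_sdiff_add_card_eq_card hVsub
    rw [card_cubeN, hV, Finset.card_biUnion hdisj] at h1
    simp only [card_shiftedCube] at h1
    rw [eq_sub_iff_add_eq]
    exact_mod_cast h1
  have hbd : ∑ w ∈ Y ∪ Z, ((ibdN (shiftedCube (m • w) (N w * m))).card : ℝ) ≤
      2 * d * ((m : ℝ) ^ d / m) *
        (∑ y ∈ Y, (n y : ℝ) ^ d / n y + ((L : ℝ) ^ d - ∑ y ∈ Y, (n y : ℝ) ^ d)) := by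
    calc _ ≤ ∑ w ∈ Y ∪ Z, 2 * d * ((m : ℝ) ^ d / m) * ((N w : ℝ) ^ d / N w) := by
          refine Finset.sum_le_sum fun w _ => ?_
          refine (card_ibdN_shiftedCube_le _ (Nat.mul_pos (hNpos w) hm)).trans_eq ?_
          push_cast
          rw [mul_pow, mul_comm (N w : ℝ), mul_comm ((N w : ℝ) ^ d), mul_div_mul_comm]
          ring
      _ = _ := by
          rw [← Finset.mul_sum, Finset.sum_union hYZ, ← hcardZ]
          congr 2
          · exact Finset.sum_congr rfl fun y hy => by rw [hNY y hy]
          · rw [Finset.card_eq_sum_ones]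
            push_cast
            exact Finset.sum_congr rfl fun z hz => by rw [hNZ z hz]; simp
  have hblocks : ∑ y ∈ Y, blockExcess τ F m (n y) (τ (m • y) ω) =
      ∑ y ∈ Y, F (cubeN d (n y * m)) (τ (m • y) ω) -
        ∑ z ∈ V, F (cubeN d m) (τ (m • z) ω) := by
    rw [hV, Finset.sum_biUnion hdisj, ← Finset.sum_sub_distrib]
    refine Finset.sum_congr rfl fun y _ => ?_
    rw [blockExcess, sum_cubeN_comp (τ := fun u => τ (m • u)) (hF.smul_semigroup m)]
  have hVZ := Finset.sum_sdiff hVsub (f := fun z => F (cubeN d m) (τ (m • z) ω))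
  have hA := mul_le_mul_of_nonneg_left hbd (hF.Anonneg ω)
  rw [hblocks, blockExcess]
  linarith

lemma cubeSuperadditive_blockExcess (hF : AlmostSuperadditive μ τ F A) {m : ℕ} (hm : 0 < m) :
    CubeSuperadditive (fun u => τ (m • u)) (blockExcess τ F m)
      (fun ω => 2 * d * ((m : ℝ) ^ d / m) * A ω) := by
  intro L Y n hL hn hsub hdisj ω
  refine (hF.sum_blockExcess_le hm hL Y n hn hsub hdisj ω).trans ?_
  have h1 : ∑ y ∈ Y, (n y : ℝ) ^ d / n y ≤ ∑ y ∈ Y, (n y : ℝ) ^ d :=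
    Finset.sum_le_sum fun y hy =>
      div_le_self (by positivity) (by exact_mod_cast hn y hy)
  have h2 : A ω * (2 * d * ((m : ℝ) ^ d / m) *
      (∑ y ∈ Y, (n y : ℝ) ^ d / n y + ((L : ℝ) ^ d - ∑ y ∈ Y, (n y : ℝ) ^ d))) ≤
      A ω * (2 * d * ((m : ℝ) ^ d / m) * (L : ℝ) ^ d) := by
    have := hF.Anonneg ω
    gcongr
    linarith
  linarith

lemma blockExcess_lower_bound (hF : AlmostSuperadditive μ τ F A) {m : ℕ} (hm : 0 < m) {L : ℕ}
    (hL : 0 < L) (ω : Ω) :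
    0 ≤ blockExcess τ F m L ω + 2 * d * ((m : ℝ) ^ d / m) * A ω * (L : ℝ) ^ d := by
  simpa using hF.cubeSuperadditive_blockExcess hm L ∅ (fun _ => 1) hL (by simp) (by simp)
    (by simp) ω

/-- After adding a multiple of the volume, the excess over single sites is monotone up to a
boundary term. -/
lemma blockExcess_one_mono (hF : AlmostSuperadditive μ τ F A) {j k : ℕ} (hj : 0 < j)
    (hjk : j ≤ k) (ω : Ω) :
    blockExcess τ F 1 j ω + 2 * d * A ω * (j : ℝ) ^ d ≤
      blockExcess τ F 1 k ω + 2 * d * A ω * (k : ℝ) ^ d + 2 * d * A ω * ((j : ℝ) ^ d / j) := by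
  have h := hF.sum_blockExcess_le one_pos (hj.trans_le hjk) {0} (fun _ => j) (by simpa using hj)
    (by
      simp only [Finset.mem_singleton, forall_eq, shiftedCube_zero]
      intro x hx
      rw [mem_cubeN] at hx ⊢
      exact fun i => (hx i).trans_le hjk)
    (by simp) ω
  have hzero : blockExcess τ F 1 j (τ (1 • 0) ω) = blockExcess τ F 1 j ω := by
    rw [blockExcess, blockExcess, sum_cubeN_comp (τ := fun u => τ (1 • u)) (hF.smul_semigroup 1),
      shiftedCube_zero, smul_zero, ← hF.apply_shiftedCube 0 (by simpa using hj), shiftedCube_zero]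
  simp only [Finset.sum_singleton, hzero, Nat.cast_one, one_pow, div_one, mul_one] at h
  linarith

end AlmostSuperadditive

end BlockExcess

section Interpolation

lemma tendsto_div_pow_of_abs_sub_le {j : ℕ → ℕ} {m : ℕ} (d : ℕ)
    (h : ∀ k, |(j k : ℝ) - k| ≤ m) :
    Tendsto (fun k : ℕ => (j k : ℝ) ^ d / (k : ℝ) ^ d) atTop (nhds 1) := by
  have h1 : Tendsto (fun k : ℕ => (j k : ℝ) / k) atTop (nhds 1) := by
    rw [tendsto_iff_norm_sub_tendsto_zero]
    refine squeeze_zero' (Eventually.of_forall fun _ => norm_nonneg _) ?_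
      (tendsto_const_div_atTop_nhds_zero_nat (m : ℝ))
    filter_upwards [eventually_gt_atTop 0] with k hk
    have hk' : (0 : ℝ) < k := by exact_mod_cast hk
    rw [Real.norm_eq_abs, div_sub_one hk'.ne', abs_div, abs_of_pos hk']
    gcongr
    exact h k
  simpa [div_pow] using h1.pow d

/-- A sequence which is monotone up to boundary terms has the same asymptotic bounds, relative to
`k ^ d`, as its restriction to the multiples of `m`. -/
lemma eventually_div_pow_mem_of_almost_monotone {d m : ℕ} (hm : 0 < m) {p : ℕ → ℝ} {C a b : ℝ}
    (hp : ∀ j k, 0 < j → j ≤ k → p j ≤ p k + C * ((j : ℝ) ^ d / j))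
    (hab : ∀ᶠ n : ℕ in atTop, a ≤ p (n * m) / ((n * m : ℕ) : ℝ) ^ d ∧
      p (n * m) / ((n * m : ℕ) : ℝ) ^ d ≤ b) {ε : ℝ} (hε : 0 < ε) :
    ∀ᶠ k : ℕ in atTop, a - ε ≤ p k / (k : ℝ) ^ d ∧ p k / (k : ℝ) ^ d ≤ b + ε := by
  have hdiv : Tendsto (fun k : ℕ => k / m) atTop atTop := Nat.tendsto_div_const_atTop hm.ne'
  have hlow : ∀ k, k / m * m ≤ k := fun k => Nat.div_mul_le_self k m
  have hupp : ∀ k, k ≤ (k / m + 1) * m := fun k => by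
    have := Nat.lt_div_mul_add (a := k) hm
    rw [add_mul, one_mul]; exact this.le
  have hr := tendsto_div_pow_of_abs_sub_le (j := fun k => k / m * m) (m := m) d fun k => by
    have h1 : ((k / m * m : ℕ) : ℝ) ≤ k := by exact_mod_cast hlow k
    have h2 : (k : ℝ) ≤ ((k / m * m : ℕ) : ℝ) + m := by
      exact_mod_cast (Nat.lt_div_mul_add (a := k) hm).le
    rw [abs_le]; constructor <;> linarith
  have hR := tendsto_div_pow_of_abs_sub_le (j := fun k => (k / m + 1) * m) (m := m) d fun k => by
    have h1 : ((k / m * m : ℕ) : ℝ) ≤ k := by exact_mod_cast hlow k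
    have h2 : (k : ℝ) ≤ (((k / m + 1) * m : ℕ) : ℝ) := by exact_mod_cast hupp k
    have h3 : (((k / m + 1) * m : ℕ) : ℝ) = ((k / m * m : ℕ) : ℝ) + m := by
      push_cast; ring
    rw [abs_le]; constructor <;> linarith
  have hinv : Tendsto (fun k : ℕ => C / ((k / m * m : ℕ) : ℝ)) atTop (nhds 0) :=
    (tendsto_const_div_atTop_nhds_zero_nat C).comp (hdiv.atTop_mul_const' hm)
  have hL : Tendsto (fun k : ℕ => (a - C / ((k / m * m : ℕ) : ℝ)) *
      (((k / m * m : ℕ) : ℝ) ^ d / (k : ℝ) ^ d)) atTop (nhds a) := by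
    simpa using (hinv.const_sub a).mul hr
  have hU : Tendsto (fun k : ℕ => b * ((((k / m + 1) * m : ℕ) : ℝ) ^ d / (k : ℝ) ^ d) + C / k)
      atTop (nhds b) := by
    simpa using (hR.const_mul b).add (tendsto_const_div_atTop_nhds_zero_nat C)
  filter_upwards [hL.eventually_const_le (sub_lt_self a hε),
    hU.eventually_le_const (lt_add_of_pos_right b hε), hdiv.eventually hab,
    ((tendsto_add_atTop_nat 1).comp hdiv).eventually hab, eventually_ge_atTop m]
    with k h1 h2 h3 h4 hk
  have hk0 : 0 < k := hm.trans_le hk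
  have hkd : (0 : ℝ) < (k : ℝ) ^ d := by positivity
  have hj0 : 0 < k / m * m := Nat.mul_pos (Nat.div_pos hk hm) hm
  have hJ0 : 0 < (k / m + 1) * m := by positivity
  constructor
  · refine h1.trans ?_
    have h5 := hp _ _ hj0 (hlow k)
    have h6 := (le_div_iff₀ (by positivity)).1 h3.1
    rw [le_div_iff₀ hkd, mul_assoc, div_mul_cancel₀ _ hkd.ne', sub_mul, div_mul_eq_mul_div,
      mul_div_assoc]
    linarith
  · refine le_trans ?_ h2
    have h5 := hp _ _ hk0 (hupp k)
    have h6 := (div_le_iff₀ (by positivity)).1 h4.2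
    rw [div_le_iff₀ hkd, add_mul, mul_assoc, div_mul_cancel₀ _ hkd.ne', div_mul_eq_mul_div,
      mul_div_assoc]
    exact h5.trans (by simpa using h6)

lemma exists_forall_abs_div_pow_sub_le {d m : ℕ} (hm : 0 < m) {P s t : ℕ → ℝ} {D l r e : ℝ}
    (he : 0 < e) (hs : Tendsto (fun k => s k / (k : ℝ) ^ d) atTop (nhds l))
    (hmono : ∀ j k : ℕ, 0 < j → j ≤ k → P j - s j + D * (j : ℝ) ^ d ≤
      P k - s k + D * (k : ℝ) ^ d + D * ((j : ℝ) ^ d / j))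
    (ht : Tendsto t atTop (nhds r))
    (hPt : ∀ n : ℕ, 0 < n → |P (n * m) / ((n * m : ℕ) : ℝ) ^ d - t n| ≤ e) :
    ∃ N : ℕ, ∀ n ≥ N, ∀ k ≥ N, |P n / (n : ℝ) ^ d - P k / (k : ℝ) ^ d| ≤ 10 * e := by
  have hsplit : ∀ k : ℕ, 0 < k → (P k - s k + D * (k : ℝ) ^ d) / (k : ℝ) ^ d =
      P k / (k : ℝ) ^ d - s k / (k : ℝ) ^ d + D := by
    intro k hk
    have : (k : ℝ) ^ d ≠ 0 := by positivity
    rw [add_div, sub_div, mul_div_cancel_right₀ _ this]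
  have hs' := Metric.tendsto_nhds.1 hs e he
  simp only [Real.dist_eq, abs_lt] at hs'
  have ht' := Metric.tendsto_nhds.1 ht e he
  simp only [Real.dist_eq, abs_lt] at ht'
  have hev := eventually_div_pow_mem_of_almost_monotone hm
    (p := fun k => P k - s k + D * (k : ℝ) ^ d) hmono
    (a := r - l + D - 3 * e) (b := r - l + D + 3 * e)
    (by
      filter_upwards [(tendsto_id.atTop_mul_const' hm).eventually hs', ht', eventually_gt_atTop 0]
        with n h1 h2 hn
      have h3 := abs_le.1 (hPt n hn)
      simp only [id] at h1
      rw [hsplit _ (Nat.mul_pos hn hm)]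
      constructor <;> linarith [h1.1, h1.2, h2.1, h2.2, h3.1, h3.2]) he
  have hfinal : ∀ᶠ k : ℕ in atTop, |P k / (k : ℝ) ^ d - r| ≤ 5 * e := by
    filter_upwards [hev, hs', eventually_gt_atTop 0] with k h1 h2 hk
    rw [hsplit k hk] at h1
    rw [abs_le]
    constructor <;> linarith [h1.1, h1.2, h2.1, h2.2]
  obtain ⟨N, hN⟩ := eventually_atTop.1 hfinal
  refine ⟨N, fun n hn k hk => ?_⟩
  have h1 := abs_le.1 (hN n hn)
  have h2 := abs_le.1 (hN k hk)
  rw [abs_le]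
  constructor <;> linarith [h1.1, h1.2, h2.1, h2.2]

end Interpolation

section Expectations

variable {d : ℕ} {Ω : Type*} [MeasurableSpace Ω] {μ : Measure Ω} {τ : (Fin d → ℕ) → Ω → Ω}
  {F : Finset (Fin d → ℕ) → Ω → ℝ} {A : Ω → ℝ}

namespace AlmostSuperadditive

lemma integrable_cubeN (hF : AlmostSuperadditive μ τ F A) {n : ℕ} (hn : 0 < n) :
    Integrable (F (cubeN d n)) μ :=
  hF.int _ (isBoxN_cubeN hn)

lemma integrable_cubeN_comp (hF : AlmostSuperadditive μ τ F A) {n : ℕ} (hn : 0 < n)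
    (u : Fin d → ℕ) : Integrable (fun ω => F (cubeN d n) (τ u ω)) μ :=
  (hF.meas u).integrable_comp_of_integrable (hF.integrable_cubeN hn)

lemma integrable_blockExcess (hF : AlmostSuperadditive μ τ F A) {m n : ℕ} (hm : 0 < m)
    (hn : 0 < n) : Integrable (blockExcess τ F m n) μ :=
  (hF.integrable_cubeN (Nat.mul_pos hn hm)).sub
    (integrable_finsetSum _ fun _ _ => hF.integrable_cubeN_comp hm _)

lemma integral_cubeN {n : ℕ} (hn : 0 < n) :
    ∫ ω, F (cubeN d n) ω ∂μ = avgSeq μ F n * (n : ℝ) ^ d := by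
  have : (n : ℝ) ^ d ≠ 0 := by positivity
  rw [avgSeq, div_mul_cancel₀ _ this]

lemma integral_blockExcess (hF : AlmostSuperadditive μ τ F A) {m n : ℕ} (hm : 0 < m)
    (hn : 0 < n) : ∫ ω, blockExcess τ F m n ω ∂μ =
      (avgSeq μ F (n * m) - avgSeq μ F m) * (m : ℝ) ^ d * (n : ℝ) ^ d := by
  simp only [blockExcess]
  rw [integral_sub (hF.integrable_cubeN (Nat.mul_pos hn hm))
    (integrable_finsetSum _ fun _ _ => hF.integrable_cubeN_comp hm _),
    integral_finsetSum _ fun _ _ => hF.integrable_cubeN_comp hm _]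
  simp only [integral_comp_of_measurePreserving (hF.meas _) (hF.integrable_cubeN hm),
    Finset.sum_const, card_cubeN, nsmul_eq_mul]
  rw [integral_cubeN hm, integral_cubeN (Nat.mul_pos hn hm)]
  push_cast
  ring

lemma avgSeq_lower_bound (hF : AlmostSuperadditive μ τ F A) {n : ℕ} (hn : 0 < n) :
    avgSeq μ F 1 - 2 * d * ∫ ω, A ω ∂μ ≤ avgSeq μ F n := by
  have h1 : 0 ≤ ∫ ω, (blockExcess τ F 1 n ω + 2 * d * ((1 : ℝ) ^ d / 1) * A ω * (n : ℝ) ^ d) ∂μ :=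
    integral_nonneg fun ω => by
      simpa using hF.blockExcess_lower_bound one_pos hn ω
  rw [integral_add (hF.integrable_blockExcess one_pos hn)
    ((hF.Aint.const_mul _).mul_const _), integral_mul_const, integral_const_mul,
    hF.integral_blockExcess one_pos hn] at h1
  have hnd : (0 : ℝ) < (n : ℝ) ^ d := by positivity
  simp only [mul_one, Nat.cast_one, one_pow, div_one] at h1
  rw [← add_mul] at h1
  linarith [nonneg_of_mul_nonneg_left h1 hnd]

/-- There are arbitrarily large scales whose average nearly attains the time constant. -/
lemma exists_scale (hF : AlmostSuperadditive μ τ F A)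
    (hfin : IsBoundedUnder (· ≤ ·) atTop (avgSeq μ F)) {η : ℝ} (hη : 0 < η) (M : ℕ) :
    ∃ m, M ≤ m ∧ ∀ᶠ k in atTop, avgSeq μ F k ≤ avgSeq μ F m + η := by
  have hbelow : IsBoundedUnder (· ≥ ·) atTop (avgSeq μ F) :=
    ⟨_, eventually_map.2 ((eventually_gt_atTop 0).mono fun n hn => hF.avgSeq_lower_bound hn)⟩
  have hfreq := frequently_lt_of_lt_limsup hbelow.isCoboundedUnder_le
    (sub_lt_self (limsup (avgSeq μ F) atTop) (half_pos hη))
  obtain ⟨m, hm, hmM⟩ := (hfreq.and_eventually (eventually_ge_atTop M)).exists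
  refine ⟨m, hmM, ?_⟩
  filter_upwards [eventually_lt_of_limsup_lt
    (lt_add_of_pos_right (limsup (avgSeq μ F) atTop) (half_pos hη)) hfin] with k hk
  linarith

/-- Off a set of small measure, the block excess is uniformly small. -/
lemma exists_scale_small_excess [IsFiniteMeasure μ] (hF : AlmostSuperadditive μ τ F A)
    (hfin : IsBoundedUnder (· ≤ ·) atTop (avgSeq μ F)) {e δ : ℝ} (he : 0 < e) (hδ : 0 < δ) :
    ∃ m : ℕ, 0 < m ∧ ∃ E : Set Ω, μ E ≤ ENNReal.ofReal δ ∧ ∀ ω ∉ E, ∀ n : ℕ, 0 < n →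
      |blockExcess τ F m n ω| ≤ e * ((n * m : ℕ) : ℝ) ^ d := by
  set η := e * δ / (4 * 3 ^ d) with hη
  have hηpos : 0 < η := by positivity
  set IA := 2 * d * ∫ ω, A ω ∂μ with hIA
  obtain ⟨M, hM⟩ := exists_nat_gt (IA / η)
  obtain ⟨m, hmM, hm⟩ := hF.exists_scale hfin hηpos (max M 1)
  have hm0 : 0 < m := (le_max_right M 1).trans hmM
  have hm0' : (0 : ℝ) < m := by exact_mod_cast hm0
  have hmd : (0 : ℝ) < (m : ℝ) ^ d := by positivity
  have hIAm : IA / m ≤ η := by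
    have h1 : (M : ℝ) ≤ m := by exact_mod_cast (le_max_left M 1).trans hmM
    rw [div_le_iff₀ hm0', mul_comm, ← div_le_iff₀ hηpos]
    linarith
  have h3η : 3 ^ d * (2 * η) = e * (δ / 2) := by
    rw [hη]; field_simp; norm_num
  set E₁ : Set Ω := {ω | ∃ n : ℕ, 0 < n ∧ e * (m : ℝ) ^ d * (n : ℝ) ^ d < blockExcess τ F m n ω}
  set E₂ : Set Ω := {ω | e * m ≤ 2 * d * A ω}
  have hE₁ : μ.real E₁ ≤ δ / 2 := by
    have hmax := (hF.cubeSuperadditive_blockExcess hm0).maximal (μ := μ)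
      (c := η * (m : ℝ) ^ d) (α := e * (m : ℝ) ^ d) (fun u => hF.meas _)
      (fun n hn => hF.integrable_blockExcess hm0 hn) (hF.Aint.const_mul _)
      (by
        filter_upwards [(tendsto_id.atTop_mul_const' hm0).eventually hm, eventually_gt_atTop 0]
          with L hL hL0
        rw [hF.integral_blockExcess hm0 hL0]
        gcongr
        simp only [id] at hL
        linarith) (by positivity)
    rw [integral_const_mul] at hmax
    change e * (m : ℝ) ^ d * μ.real E₁ ≤ _ at hmax
    have hrhs : 3 ^ d * (η * (m : ℝ) ^ d + 2 * d * ((m : ℝ) ^ d / m) * ∫ ω, A ω ∂μ) =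
        (m : ℝ) ^ d * (3 ^ d * (η + IA / m)) := by
      rw [hIA]; ring
    rw [hrhs, mul_comm e, mul_assoc] at hmax
    have h1 := le_of_mul_le_mul_left hmax hmd
    have h2 : 3 ^ d * (η + IA / m) ≤ 3 ^ d * (2 * η) := by gcongr; linarith
    exact le_of_mul_le_mul_left (h1.trans (h2.trans_eq h3η)) he
  have hE₂ : μ.real E₂ ≤ δ / 2 := by
    have hmarkov := mul_meas_ge_le_integral_of_nonneg (μ := μ) (f := fun ω => 2 * d * A ω)
      (Eventually.of_forall fun ω => by have := hF.Anonneg ω; simp only [Pi.zero_apply]; positivity)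
      (hF.Aint.const_mul _) (e * m)
    rw [integral_const_mul, ← hIA] at hmarkov
    have h1 : e * μ.real E₂ ≤ IA / m := by
      rw [le_div_iff₀ hm0']
      linarith
    have h2 : η ≤ 3 ^ d * (2 * η) := by
      have : (1 : ℝ) ≤ 3 ^ d := one_le_pow₀ (by norm_num)
      nlinarith
    exact le_of_mul_le_mul_left ((h1.trans hIAm).trans (h2.trans_eq h3η)) he
  refine ⟨m, hm0, E₁ ∪ E₂, ?_, fun ω hω n hn => ?_⟩
  · rw [← ofReal_measureReal]
    exact ENNReal.ofReal_le_ofReal ((measureReal_union_le _ _).trans (by linarith))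
  · have hω₁ : ω ∉ E₁ := fun h => hω (Or.inl h)
    have hω₂ : 2 * d * A ω < e * m := not_le.1 fun h => hω (Or.inr h)
    have hnm : e * ((n * m : ℕ) : ℝ) ^ d = e * (m : ℝ) ^ d * (n : ℝ) ^ d := by
      push_cast; ring
    rw [hnm, abs_le]
    constructor
    · have h1 := hF.blockExcess_lower_bound hm0 hn ω
      have h2 : 2 * d * ((m : ℝ) ^ d / m) * A ω ≤ e * (m : ℝ) ^ d := by
        have h3 : 2 * d * ((m : ℝ) ^ d / m) * A ω = 2 * d * A ω / m * (m : ℝ) ^ d := by ring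
        rw [h3]
        gcongr
        rw [div_le_iff₀ hm0']
        exact hω₂.le
      have h4 := mul_le_mul_of_nonneg_right h2 (by positivity : (0 : ℝ) ≤ (n : ℝ) ^ d)
      linarith
    · by_contra hcon
      exact hω₁ ⟨n, hn, not_le.1 hcon⟩

end AlmostSuperadditive

end Expectations

/-- **Almost-sure existence of the limit**: for an almost superadditive process `F` with
finite time constant, the limit `lim_n |S_n|⁻¹ F_{S_n}(ω)` exists for almost every `ω`. -/
theorem ae_limit_exists {d : ℕ} {Ω : Type*} [MeasurableSpace Ω] (μ : Measure Ω)
    [IsProbabilityMeasure μ]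
    (τ : (Fin d → ℕ) → Ω → Ω) (F : Finset (Fin d → ℕ) → Ω → ℝ) (A : Ω → ℝ)
    (hF : AlmostSuperadditive μ τ F A)
    (hfin : IsBoundedUnder (· ≤ ·) atTop (avgSeq μ F)) :
    ∀ᵐ ω ∂μ, ∃ L : ℝ,
      Filter.Tendsto (fun n => F (cubeN d n) ω / (n : ℝ) ^ d) atTop (nhds L) := by
  refine ae_exists_tendsto_of_small_oscillation fun ε hε => ?_
  obtain ⟨m, hm, E, hE, hsmall⟩ :=
    hF.exists_scale_small_excess hfin (e := ε / 10) (by positivity) hε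
  refine ⟨E, hE, ?_⟩
  filter_upwards [CubeAverageConverges.of_integrable (τ := fun u => τ (1 • u))
      (fun u => hF.meas _) (hF.smul_semigroup 1) (hF.integrable_cubeN one_pos),
    CubeAverageConverges.of_integrable (τ := fun u => τ (m • u))
      (fun u => hF.meas _) (hF.smul_semigroup m) (hF.integrable_cubeN hm)]
    with ω ⟨l, hl⟩ ⟨r, hr⟩ hω
  obtain ⟨N, hN⟩ := exists_forall_abs_div_pow_sub_le hm (P := fun k => F (cubeN d k) ω)
    (s := fun k => ∑ x ∈ cubeN d k, F (cubeN d 1) (τ (1 • x) ω)) (D := 2 * d * A ω)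
    (e := ε / 10) (by positivity) hl
    (fun j k hj hjk => by
      have := hF.blockExcess_one_mono hj hjk ω
      simp only [blockExcess, mul_one] at this
      exact this)
    (hr.div_const ((m : ℝ) ^ d))
    (fun n hn => by
      have hnm : (0 : ℝ) < ((n * m : ℕ) : ℝ) ^ d := by positivity
      have heq : F (cubeN d (n * m)) ω / ((n * m : ℕ) : ℝ) ^ d -
          cubeAverage (fun u => τ (m • u)) (F (cubeN d m)) n ω / (m : ℝ) ^ d =
          blockExcess τ F m n ω / ((n * m : ℕ) : ℝ) ^ d := by
        rw [cubeAverage, blockExcess, div_div, ← mul_pow, Nat.cast_mul, sub_div]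
      rw [heq, abs_div, abs_of_pos hnm, div_le_iff₀ hnm]
      exact hsmall ω hω n hn)
  exact ⟨N, fun n hn k hk => (hN n hn k hk).trans_eq (by ring)⟩
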